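/- Let a > 0. There is no C² function F : (0,1) → (−a, 0) with F'(r) > 0 for all r ∈ (0,1), lim_{r→0⁺} F(r) = −a, lim_{r→1⁻} F(r) = 0, satisfying F''(r) + F'(r)/r − (π/a)·cot((π/a)·F(r))·F'(r)² + (1/r²)·(π/a)·cot((π/a)·F(r)) = 0 for all r ∈ (0,1). -/

import Mathlib

open Real Set Filter Topology

/-- First integral: `((r F')² - 1) / sin² (k F)` has zero derivative along a solution of the
equation with coefficient `k`. -/
theorem hasDerivAt_firstIntegral {F : ℝ → ℝ} {k r : ℝ} (hr : r ≠ 0)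
    (hs : Real.sin (k * F r) ≠ 0) (h1 : DifferentiableAt ℝ F r)
    (h2 : DifferentiableAt ℝ (deriv F) r)
    (hode : deriv (deriv F) r + deriv F r / r - k * Real.cot (k * F r) * (deriv F r) ^ 2 +
      1 / r ^ 2 * (k * Real.cot (k * F r)) = 0) :
    HasDerivAt (fun x => ((x * deriv F x) ^ 2 - 1) / Real.sin (k * F x) ^ 2) 0 r := by
  have hnum := (((hasDerivAt_id r).mul h2.hasDerivAt).pow 2).sub_const 1
  have hden := ((h1.hasDerivAt.const_mul k).sin).pow 2
  refine (hnum.div hden (pow_ne_zero 2 hs)).congr_deriv ?_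
  rw [Real.cot_eq_cos_div_sin] at hode
  simp only [Pi.mul_apply, Pi.pow_apply, id]
  generalize deriv (deriv F) r = q at *
  generalize deriv F r = p at *
  generalize Real.sin (k * F r) = s at *
  generalize Real.cos (k * F r) = c at *
  field_simp at hode
  rw [div_eq_zero_iff]
  left
  push_cast
  simp only [pow_one, one_mul]
  linear_combination 2 * p * s * hode

/-- A function whose derivative is at least `1 / (2 r)` near `0⁺` is unbounded below there. -/
theorem not_bddBelow_of_half_le_mul_deriv {F : ℝ → ℝ} {δ m : ℝ} (hδ : 0 < δ)
    (hF : ∀ r ∈ Ioo 0 δ, DifferentiableAt ℝ F r)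
    (hF' : ∀ r ∈ Ioo 0 δ, 1 / 2 ≤ r * deriv F r) :
    ¬ ∀ r ∈ Ioo 0 δ, m ≤ F r := by
  intro hm
  have hd : ∀ r ∈ Ioo 0 δ,
      HasDerivAt (fun x => F x - 1 / 2 * Real.log x) (deriv F r - 1 / 2 * r⁻¹) r :=
    fun r hr => (hF r hr).hasDerivAt.sub ((Real.hasDerivAt_log hr.1.ne').const_mul _)
  have hmono : MonotoneOn (fun x => F x - 1 / 2 * Real.log x) (Ioo 0 δ) := by
    refine monotoneOn_of_deriv_nonneg (convex_Ioo 0 δ)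
      (fun r hr => (hd r hr).continuousAt.continuousWithinAt) ?_ ?_
    · rw [interior_Ioo]
      exact fun r hr => (hd r hr).differentiableAt.differentiableWithinAt
    · rw [interior_Ioo]
      intro r hr
      rw [(hd r hr).deriv, sub_nonneg, ← div_eq_mul_inv, div_le_iff₀ hr.1, mul_comm]
      exact hF' r hr
  have hmid : δ / 2 ∈ Ioo 0 δ := ⟨by linarith, by linarith⟩
  have hlog := Real.tendsto_log_nhdsGT_zero.eventually_lt_atBot
    (2 * (m - (F (δ / 2) - 1 / 2 * Real.log (δ / 2))))
  obtain ⟨r, hlr, hr⟩ := (hlog.and (Ioo_mem_nhdsGT hmid.1)).exists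
  have hr' : r ∈ Ioo 0 δ := ⟨hr.1, hr.2.trans hmid.2⟩
  have h := hmono hr' hmid hr.2.le
  have := hm r hr'
  dsimp only at h
  linarith

theorem stmt_1 (a : ℝ) (ha : 0 < a) :
    ¬ ∃ F : ℝ → ℝ,
      ContDiffOn ℝ 2 F (Ioo 0 1) ∧
      (∀ r ∈ Ioo (0:ℝ) 1, F r ∈ Ioo (-a) 0) ∧
      (∀ r ∈ Ioo (0:ℝ) 1, 0 < deriv F r) ∧
      Tendsto F (𝓝[>] (0:ℝ)) (𝓝 (-a)) ∧
      Tendsto F (𝓝[<] (1:ℝ)) (𝓝 0) ∧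
      (∀ r ∈ Ioo (0:ℝ) 1,
        deriv (deriv F) r + deriv F r / r -
          π / a * Real.cot (π / a * F r) * (deriv F r) ^ 2 +
          1 / r ^ 2 * (π / a * Real.cot (π / a * F r)) = 0) := by
  rintro ⟨F, hC, hmem, hpos, h0, -, hode⟩
  have hd1 : ∀ r ∈ Ioo (0:ℝ) 1, DifferentiableAt ℝ F r := fun r hr =>
    (hC.differentiableOn (by norm_num)).differentiableAt (isOpen_Ioo.mem_nhds hr)
  have hd2 : ∀ r ∈ Ioo (0:ℝ) 1, DifferentiableAt ℝ (deriv F) r := fun r hr =>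
    ((hC.deriv_of_isOpen (m := 1) isOpen_Ioo (by norm_num)).differentiableOn
      (by norm_num)).differentiableAt (isOpen_Ioo.mem_nhds hr)
  have hk : 0 < π / a := div_pos Real.pi_pos ha
  have hka : π / a * (-a) = -π := by field_simp
  have hsin : ∀ r ∈ Ioo (0:ℝ) 1, Real.sin (π / a * F r) ≠ 0 := fun r hr =>
    (Real.sin_neg_of_neg_of_neg_pi_lt (mul_neg_of_pos_of_neg hk (hmem r hr).2)
      (hka ▸ mul_lt_mul_of_pos_left (hmem r hr).1 hk)).ne
  have hderiv := fun r (hr : r ∈ Ioo (0:ℝ) 1) =>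
    hasDerivAt_firstIntegral hr.1.ne' (hsin r hr) (hd1 r hr) (hd2 r hr) (hode r hr)
  obtain ⟨C, hconst⟩ := isOpen_Ioo.exists_is_const_of_deriv_eq_zero isPreconnected_Ioo
    (fun r hr => (hderiv r hr).differentiableAt.differentiableWithinAt)
    (fun r hr => (hderiv r hr).deriv)
  have hlim : Tendsto (fun r => 1 + C * Real.sin (π / a * F r) ^ 2) (𝓝[>] (0:ℝ)) (𝓝 1) := by
    have hcont : Continuous fun y : ℝ => 1 + C * Real.sin (π / a * y) ^ 2 := by fun_prop
    have h := (hcont.tendsto (-a)).comp h0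
    simpa [hka, Function.comp_def] using h
  have hev := hlim.eventually_const_lt (show (1 / 4 : ℝ) < 1 by norm_num)
  obtain ⟨δ, hδ, hsub⟩ := mem_nhdsGT_iff_exists_Ioo_subset.mp
    (hev.and (Ioo_mem_nhdsGT (zero_lt_one' ℝ)))
  refine not_bddBelow_of_half_le_mul_deriv (F := F) (m := -a) hδ
    (fun r hr => hd1 r (hsub hr).2) (fun r hr => ?_) (fun r hr => (hmem r (hsub hr).2).1.le)
  obtain ⟨hq, hr1⟩ := hsub hr
  have hC' := hconst r hr1
  rw [div_eq_iff (pow_ne_zero 2 (hsin r hr1))] at hC'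
  have := mul_pos hr1.1 (hpos r hr1)
  nlinarith
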